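/- arXiv:1112.4626 — 3 statements merged into one kernel-verified Lean document; each statement's English description precedes it below -/
import Mathlib

section
/- The function A is strictly increasing on the interval (0, 2], and A(2) = 2π. -/
/-- Area of the circular segment with chord length 4 and sagitta `h`. -/
noncomputable def A (h : ℝ) : ℝ :=
  ((h ^ 2 + 4) / (2 * h)) ^ 2 * Real.arccos ((4 - h ^ 2) / (h ^ 2 + 4)) - (4 - h ^ 2) / h

theorem arccos_eq_two_mul_arctan_half {h : ℝ} (hh : 0 ≤ h) :
    Real.arccos ((4 - h ^ 2) / (h ^ 2 + 4)) = 2 * Real.arctan (h / 2) := by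
  have hcos : Real.cos (2 * Real.arctan (h / 2)) = (4 - h ^ 2) / (h ^ 2 + 4) := by
    rw [Real.cos_two_mul, Real.cos_sq_arctan]
    field_simp
    ring
  rw [← hcos, Real.arccos_cos]
  · have := Real.arctan_nonneg.2 (by positivity : 0 ≤ h / 2)
    positivity
  · linarith [Real.arctan_lt_pi_div_two (h / 2)]

theorem two_mul_arctan_half_mul_lt {h : ℝ} (h0 : 0 < h) (h2 : h < 2) :
    2 * Real.arctan (h / 2) * (4 - h ^ 2) < 4 * h := by
  have hpos : 0 < 4 - h ^ 2 := by nlinarith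
  have hθ : 2 * Real.arctan (h / 2) = Real.arctan (4 * h / (4 - h ^ 2)) := by
    rw [Real.two_mul_arctan (by linarith) (by linarith)]
    congr 1
    have h₁ : 1 - (h / 2) ^ 2 ≠ 0 := by nlinarith
    have h₂ := hpos.ne'
    rw [div_eq_div_iff h₁ h₂]
    ring
  have hlt := Real.lt_tan (Real.arctan_pos.2 (by positivity : 0 < 4 * h / (4 - h ^ 2)))
    (Real.arctan_lt_pi_div_two _)
  rw [Real.tan_arctan, ← hθ] at hlt
  exact (lt_div_iff₀ hpos).1 hlt

theorem A_eq_of_pos {h : ℝ} (hh : 0 < h) :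
    A h = ((h ^ 2 + 4) / (2 * h)) ^ 2 * (2 * Real.arctan (h / 2)) - (4 - h ^ 2) / h := by
  rw [A, arccos_eq_two_mul_arctan_half hh.le]

theorem hasDerivAt_A {h : ℝ} (hh : 0 < h) :
    HasDerivAt A
      ((h ^ 2 + 4) / (2 * h ^ 3) * (4 * h - 2 * Real.arctan (h / 2) * (4 - h ^ 2))) h := by
  have hsq : HasDerivAt (fun x : ℝ => x ^ 2) (2 * h) h := by
    simpa using hasDerivAt_pow 2 h
  have hR := ((hsq.add_const 4).fun_div ((hasDerivAt_id' h).const_mul 2)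
    (by positivity)).fun_pow 2
  have hθ := (((hasDerivAt_id' h).div_const 2).arctan).const_mul 2
  have hT := (hsq.const_sub 4).fun_div (hasDerivAt_id' h) hh.ne'
  refine (((hR.fun_mul hθ).fun_sub hT).congr_of_eventuallyEq ?_).congr_deriv ?_
  · filter_upwards [lt_mem_nhds hh] with x hx using A_eq_of_pos hx
  · simp only [Nat.add_one_sub_one, pow_one]
    have : 1 + (h / 2) ^ 2 ≠ 0 := by positivity
    field_simp
    ring

/-- `A` is strictly increasing on `(0, 2]`, and `A 2 = 2π`. -/
theorem A_strictMonoOn_and_A_two :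
    StrictMonoOn A (Set.Ioc (0 : ℝ) 2) ∧ A 2 = 2 * Real.pi := by
  constructor
  · refine strictMonoOn_of_deriv_pos (convex_Ioc 0 2)
      (fun x hx => (hasDerivAt_A hx.1).continuousAt.continuousWithinAt) fun x hx => ?_
    rw [interior_Ioc] at hx
    have hx0 := hx.1
    rw [(hasDerivAt_A hx0).deriv]
    exact mul_pos (by positivity) (sub_pos.2 (two_mul_arctan_half_mul_lt hx0 hx.2))
  · norm_num [A]
    ring
end

section
/- For all real numbers h₁, h₂ with h₁ > 0, h₂ > 0 and h₁ + h₂ ≤ 2, the strict inequality A(h₁) + A(h₂) < A(h₁ + h₂) holds. -/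
theorem arccos_eq_two_mul_arctan {x : ℝ} (hx : 0 ≤ x) :
    Real.arccos ((1 - x ^ 2) / (1 + x ^ 2)) = 2 * Real.arctan x := by
  have hcos : (1 - x ^ 2) / (1 + x ^ 2) = Real.cos (2 * Real.arctan x) := by
    rw [Real.cos_two_mul, Real.cos_sq_arctan]
    field_simp
    ring
  rw [hcos, Real.arccos_cos]
  · have := Real.arctan_nonneg.2 hx
    linarith
  · linarith [Real.arctan_lt_pi_div_two x]

theorem arctan_lt_rational {x : ℝ} (hx : 0 < x) (hx1 : x ≤ 1) :
    Real.arctan x < x * (3 + x ^ 2) / ((1 + x ^ 2) * (3 - x ^ 2)) := by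
  have hder : ∀ y ∈ Set.Icc (0 : ℝ) 1,
      HasDerivAt (fun y : ℝ => y * (3 + y ^ 2) / ((1 + y ^ 2) * (3 - y ^ 2)) - Real.arctan y)
        (16 * y ^ 4 / ((1 + y ^ 2) * (3 - y ^ 2)) ^ 2) y := by
    intro y hy
    have h3 : 3 - y ^ 2 ≠ 0 := by nlinarith [hy.1, hy.2]
    have h1 : 1 + y ^ 2 ≠ 0 := by positivity
    have hsq := hasDerivAt_pow 2 y
    refine ((((hasDerivAt_id y).mul (hsq.const_add 3)).div
      ((hsq.const_add 1).mul (hsq.const_sub 3)) (mul_ne_zero h1 h3)).sub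
      (Real.hasDerivAt_arctan y)).congr_deriv ?_
    simp only [id, Pi.mul_apply]
    field_simp
    ring
  have hmono := strictMonoOn_of_deriv_pos (convex_Icc (0 : ℝ) 1)
    (fun y hy => (hder y hy).continuousAt.continuousWithinAt) (fun y hy => by
      rw [interior_Icc] at hy
      rw [(hder y ⟨hy.1.le, hy.2.le⟩).deriv]
      have h3 : 0 < 3 - y ^ 2 := by nlinarith [hy.1, hy.2]
      have := hy.1
      positivity)
  have := hmono (Set.left_mem_Icc.2 zero_le_one) ⟨hx.le, hx1⟩ hx
  simp at this
  linarith

/-- The area of the segment divided by its sagitta, as a function of half the sagitta. -/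
noncomputable def areaRatio (x : ℝ) : ℝ :=
  (1 + x ^ 2) ^ 2 / x ^ 3 * Real.arctan x - 1 / x ^ 2 + 1

theorem A_eq_mul_areaRatio {h : ℝ} (hh : 0 < h) : A h = h * areaRatio (h / 2) := by
  have harg : (4 - h ^ 2) / (h ^ 2 + 4) = (1 - (h / 2) ^ 2) / (1 + (h / 2) ^ 2) := by
    field_simp
    ring
  rw [A, areaRatio, harg, arccos_eq_two_mul_arctan (by positivity)]
  field_simp
  ring

theorem areaRatio_strictMonoOn : StrictMonoOn areaRatio (Set.Ioc 0 1) := by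
  have hder : ∀ y ∈ Set.Ioc (0 : ℝ) 1, HasDerivAt areaRatio
      ((1 + y ^ 2) * (3 - y ^ 2) / y ^ 4 *
        (y * (3 + y ^ 2) / ((1 + y ^ 2) * (3 - y ^ 2)) - Real.arctan y)) y := by
    intro y hy
    have h0 : y ≠ 0 := hy.1.ne'
    have h3 : 3 - y ^ 2 ≠ 0 := by nlinarith [hy.1, hy.2]
    have hsq := hasDerivAt_pow 2 y
    refine ((((((hsq.const_add 1).pow 2).div (hasDerivAt_pow 3 y) (pow_ne_zero 3 h0)).mul
      (Real.hasDerivAt_arctan y)).sub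
      ((hasDerivAt_const y (1 : ℝ)).div hsq (pow_ne_zero 2 h0))).add_const 1).congr_deriv ?_
    simp only [Pi.pow_apply, Pi.div_apply]
    field_simp
    ring
  refine strictMonoOn_of_deriv_pos (convex_Ioc (0 : ℝ) 1)
    (fun y hy => (hder y hy).continuousAt.continuousWithinAt) (fun y hy => ?_)
  rw [interior_Ioc] at hy
  rw [(hder y ⟨hy.1, hy.2.le⟩).deriv]
  have h3 : 0 < 3 - y ^ 2 := by nlinarith [hy.1, hy.2]
  have h0 := hy.1
  have := sub_pos.2 (arctan_lt_rational hy.1 hy.2.le)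
  positivity

/-- Strict superadditivity of circular segment areas. -/
theorem A_strict_superadditive (h₁ h₂ : ℝ) (h₁0 : 0 < h₁) (h₂0 : 0 < h₂)
    (hsum : h₁ + h₂ ≤ 2) :
    A h₁ + A h₂ < A (h₁ + h₂) := by
  have hs : (h₁ + h₂) / 2 ∈ Set.Ioc (0 : ℝ) 1 := ⟨by linarith, by linarith⟩
  have r₁ : areaRatio (h₁ / 2) < areaRatio ((h₁ + h₂) / 2) :=
    areaRatio_strictMonoOn ⟨by linarith, by linarith⟩ hs (by linarith)
  have r₂ : areaRatio (h₂ / 2) < areaRatio ((h₁ + h₂) / 2) :=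
    areaRatio_strictMonoOn ⟨by linarith, by linarith⟩ hs (by linarith)
  rw [A_eq_mul_areaRatio h₁0, A_eq_mul_areaRatio h₂0, A_eq_mul_areaRatio (add_pos h₁0 h₂0),
    add_mul]
  exact add_lt_add (mul_lt_mul_of_pos_left r₁ h₁0) (mul_lt_mul_of_pos_left r₂ h₂0)
end

section
/- Let h₁, h₂ be real numbers with 0 < h₁ ≤ 2, 0 < h₂ ≤ 2, and h₁ + h₂ > 2. Let C₁ be the circle centered at ((h₁² − 4)/(2h₁), 2) with radius (h₁² + 4)/(2h₁) (this circle passes through (0,0) and (0,4) and has rightmost point (h₁, 2)), and let C₂ be the circle centered at (2 − (h₂² − 4)/(2h₂), 2) with radius (h₂² + 4)/(2h₂) (this circle passes through (2,0) and (2,4) and has leftmost point (2 − h₂, 2)). Then the arcs {p ∈ C₁ | p.1 ≥ 0} and {p ∈ C₂ | p.1 ≤ 2} have a common point. -/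
/-- Euclidean distance on `ℝ × ℝ` (Mathlib's `dist` on the product is the sup metric). -/
noncomputable def euclDist (p q : ℝ × ℝ) : ℝ :=
  Real.sqrt ((p.1 - q.1) ^ 2 + (p.2 - q.2) ^ 2)

theorem euclDist_eq_of_sq_add_sq_eq_sq {p q : ℝ × ℝ} {r : ℝ} (hr : 0 ≤ r)
    (h : (p.1 - q.1) ^ 2 + (p.2 - q.2) ^ 2 = r ^ 2) : euclDist p q = r := by
  rw [euclDist, h, Real.sqrt_sq hr]

/-- Pythagoras for the radius and half the chord of a circular arc of sagitta `h` over a chord of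
length `4`. -/
theorem sq_radius_eq_sq_center_add_four {h : ℝ} (h0 : 0 < h) :
    ((h ^ 2 + 4) / (2 * h)) ^ 2 = ((h ^ 2 - 4) / (2 * h)) ^ 2 + 4 := by
  field_simp
  ring

/-- On the circle centered at `((h ^ 2 - 4) / (2 * h), 0)` through `(0, ±2)`, the left side is the square
of the ordinate at abscissa `x`, which vanishes at `x = h` and `x = -4 / h`. -/
theorem four_sub_sq_add_eq_mul {h : ℝ} (h0 : 0 < h) (x : ℝ) :
    4 - x ^ 2 + 2 * ((h ^ 2 - 4) / (2 * h)) * x = (h - x) * (x + 4 / h) := by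
  field_simp
  ring

/-- If the sagittas `h₁, h₂ ∈ (0,2]` of inward arcs on the two long sides of the
rectangle `[0,2] × [0,4]` satisfy `h₁ + h₂ > 2`, then the arc of the circle through
`(0,0)` and `(0,4)` with rightmost point `(h₁, 2)` lying in `{p.1 ≥ 0}` and the arc of
the circle through `(2,0)` and `(2,4)` with leftmost point `(2 − h₂, 2)` lying in
`{p.1 ≤ 2}` have a common point. -/
theorem inward_arcs_intersect (h₁ h₂ : ℝ) (h₁0 : 0 < h₁) (h₁2 : h₁ ≤ 2)
    (h₂0 : 0 < h₂) (h₂2 : h₂ ≤ 2) (hsum : 2 < h₁ + h₂) :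
    ∃ p : ℝ × ℝ,
      euclDist p ((h₁ ^ 2 - 4) / (2 * h₁), 2) = (h₁ ^ 2 + 4) / (2 * h₁) ∧ p.1 ≥ 0 ∧
      euclDist p (2 - (h₂ ^ 2 - 4) / (2 * h₂), 2) = (h₂ ^ 2 + 4) / (2 * h₂) ∧ p.1 ≤ 2 := by
  have center_nonpos {h : ℝ} (h0 : 0 < h) (h2 : h ≤ 2) : (h ^ 2 - 4) / (2 * h) ≤ 0 :=
    div_nonpos_of_nonpos_of_nonneg (by nlinarith) (by positivity)
  have ha := center_nonpos h₁0 h₁2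
  have hb := center_nonpos h₂0 h₂2
  have ra := sq_radius_eq_sq_center_add_four h₁0
  have rb := sq_radius_eq_sq_center_add_four h₂0
  have fa := four_sub_sq_add_eq_mul h₁0
  have fb := four_sub_sq_add_eq_mul h₂0
  have ra0 : 0 ≤ (h₁ ^ 2 + 4) / (2 * h₁) := by positivity
  have rb0 : 0 ≤ (h₂ ^ 2 + 4) / (2 * h₂) := by positivity
  generalize (h₁ ^ 2 - 4) / (2 * h₁) = a at *
  generalize (h₂ ^ 2 - 4) / (2 * h₂) = b at *
  obtain ⟨x, hx⟩ : ∃ x, x * (2 - a - b) = 2 * (1 - b) :=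
    ⟨2 * (1 - b) / (2 - a - b), div_mul_cancel₀ _ (by linarith)⟩
  have hx0 : 0 ≤ x := by
    by_contra! hneg
    nlinarith
  have hx2 : x ≤ 2 := by
    by_contra! hgt
    nlinarith
  have heq : 4 - x ^ 2 + 2 * a * x = 4 - (2 - x) ^ 2 + 2 * b * (2 - x) := by
    linear_combination -2 * hx
  have hnonneg : 0 ≤ 4 - x ^ 2 + 2 * a * x := by
    rcases le_total x h₁ with hxh | hxh
    · rw [fa]
      exact mul_nonneg (by linarith) (by positivity)
    · rw [heq, fb]
      exact mul_nonneg (by linarith) (add_nonneg (by linarith) (by positivity))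
  have hy := Real.sq_sqrt hnonneg
  refine ⟨(x, 2 + √(4 - x ^ 2 + 2 * a * x)), euclDist_eq_of_sq_add_sq_eq_sq ra0 ?_, hx0,
    euclDist_eq_of_sq_add_sq_eq_sq rb0 ?_, hx2⟩
  · linear_combination hy - ra
  · linear_combination hy - rb + heq
end
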